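/- arXiv:1812.09320 — 3 statements merged into one kernel-verified Lean document; each statement's English description precedes it below -/
import Mathlib

section
/- For all real numbers 0 < λ < μ and 0 < α with α < λ and α < μ − λ, the average exponential PCoUD of the M/M/1 FCFS system satisfies ∫_0^∞ (e^{α t} − 1)·A(t) dt = α·( 3α²μ − α³ + α(λ² − λμ − 3μ²) + μ³ ) / ( (λ−α)(α−μ)²(μ−λ−α) ). -/
open MeasureTheory Real

lemma integrableOn_exp_neg_mul_Ioi {r : ℝ} (hr : 0 < r) :
    IntegrableOn (fun t : ℝ => Real.exp (-r * t)) (Set.Ioi 0) :=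
  integrableOn_exp_mul_Ioi (neg_lt_zero.mpr hr) 0

lemma integral_exp_neg_mul_Ioi {r : ℝ} (hr : 0 < r) :
    ∫ t in Set.Ioi (0 : ℝ), Real.exp (-r * t) = 1 / r := by
  rw [integral_exp_mul_Ioi (neg_lt_zero.mpr hr) 0]
  simp

lemma integrableOn_mul_exp_neg_mul_Ioi {r : ℝ} (hr : 0 < r) :
    IntegrableOn (fun t : ℝ => t * Real.exp (-r * t)) (Set.Ioi 0) := by
  simpa using integrableOn_rpow_mul_exp_neg_mul_rpow (p := 1) (s := 1) (by norm_num) one_pos hr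

lemma integral_mul_exp_neg_mul_Ioi {r : ℝ} (hr : 0 < r) :
    ∫ t in Set.Ioi (0 : ℝ), t * Real.exp (-r * t) = 1 / r ^ 2 := by
  have h := integral_rpow_mul_exp_neg_mul_Ioi (a := 2) two_pos hr
  norm_num at h
  simpa using h

/-- A combination of three exponentials and a term `t * exp (-a * t)` is integrable on the positive
half-line. -/
lemma integrableOn_exp_combination {a b c : ℝ} (ha : 0 < a) (hb : 0 < b) (hc : 0 < c)
    (p q r s : ℝ) :
    IntegrableOn (fun t : ℝ => p * Real.exp (-a * t) + q * Real.exp (-b * t)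
      + r * Real.exp (-c * t) - s * (t * Real.exp (-a * t))) (Set.Ioi 0) :=
  ((((integrableOn_exp_neg_mul_Ioi ha).const_mul p).add
    ((integrableOn_exp_neg_mul_Ioi hb).const_mul q)).add
    ((integrableOn_exp_neg_mul_Ioi hc).const_mul r)).sub
    ((integrableOn_mul_exp_neg_mul_Ioi ha).const_mul s)

lemma integral_exp_combination {a b c : ℝ} (ha : 0 < a) (hb : 0 < b) (hc : 0 < c)
    (p q r s : ℝ) :
    ∫ t in Set.Ioi (0 : ℝ), (p * Real.exp (-a * t) + q * Real.exp (-b * t)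
      + r * Real.exp (-c * t) - s * (t * Real.exp (-a * t)))
      = p / a + q / b + r / c - s / a ^ 2 := by
  have hp := (integrableOn_exp_neg_mul_Ioi ha).const_mul p
  have hq := (integrableOn_exp_neg_mul_Ioi hb).const_mul q
  have hr := (integrableOn_exp_neg_mul_Ioi hc).const_mul r
  have hs := (integrableOn_mul_exp_neg_mul_Ioi ha).const_mul s
  rw [integral_sub ((hp.fun_add hq).fun_add hr) hs, integral_add (hp.fun_add hq) hr,
    integral_add hp hq]
  simp only [integral_const_mul, integral_exp_neg_mul_Ioi ha, integral_exp_neg_mul_Ioi hb,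
    integral_exp_neg_mul_Ioi hc, integral_mul_exp_neg_mul_Ioi ha]
  ring

/-- Integral of a combination of exponentials against the cost function `exp (x * t) - 1`. -/
lemma integral_exp_sub_one_mul_exp_combination {a b c x : ℝ} (ha : 0 < a) (hb : 0 < b)
    (hc : 0 < c) (hxa : x < a) (hxb : x < b) (hxc : x < c) (p q r s : ℝ) :
    ∫ t in Set.Ioi (0 : ℝ), (Real.exp (x * t) - 1) * (p * Real.exp (-a * t)
      + q * Real.exp (-b * t) + r * Real.exp (-c * t) - s * t * Real.exp (-a * t))
      = (p / (a - x) + q / (b - x) + r / (c - x) - s / (a - x) ^ 2)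
        - (p / a + q / b + r / c - s / a ^ 2) := by
  rw [← integral_exp_combination ha hb hc,
    ← integral_exp_combination (sub_pos.mpr hxa) (sub_pos.mpr hxb) (sub_pos.mpr hxc),
    ← integral_sub
      (integrableOn_exp_combination (sub_pos.mpr hxa) (sub_pos.mpr hxb) (sub_pos.mpr hxc) p q r s)
      (integrableOn_exp_combination ha hb hc p q r s)]
  congr 1 with t
  have h (y : ℝ) : Real.exp (-(y - x) * t) = Real.exp (x * t) * Real.exp (-y * t) := by
    rw [← Real.exp_add]
    ring_nf
  rw [h a, h b, h c]
  ring

/-- Average exponential PCoUD of the M/M/1 FCFS queue, where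
`A(t) = (μ(2λ²−2λμ+μ²)/(λ(λ−μ)))e^{−μt} + (μ(μ−λ)/λ)e^{−(μ−λ)t}
        + (λμ/(μ−λ))e^{−λt} − μ² t e^{−μt}`
is the stationary PCoUD density. -/
theorem avg_exponential_PCoUD (lam mu alpha : ℝ) (hlam : 0 < lam) (hlm : lam < mu)
    (halpha : 0 < alpha) (hal : alpha < lam) (ham : alpha < mu - lam) :
    (∫ t in Set.Ioi (0:ℝ), (Real.exp (alpha * t) - 1) *
        ((mu * (2 * lam ^ 2 - 2 * lam * mu + mu ^ 2) / (lam * (lam - mu))) * Real.exp (-mu * t)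
          + (mu * (mu - lam) / lam) * Real.exp (-(mu - lam) * t)
          + (lam * mu / (mu - lam)) * Real.exp (-lam * t)
          - mu ^ 2 * t * Real.exp (-mu * t)))
      = alpha * (3 * alpha ^ 2 * mu - alpha ^ 3 + alpha * (lam ^ 2 - lam * mu - 3 * mu ^ 2) + mu ^ 3)
          / ((lam - alpha) * (alpha - mu) ^ 2 * (mu - lam - alpha)) := by
  have hmu : 0 < mu := hlam.trans hlm
  have hml : 0 < mu - lam := sub_pos.mpr hlm
  have ham' : alpha < mu := hal.trans hlm
  rw [integral_exp_sub_one_mul_exp_combination hmu hml hlam ham' ham hal]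
  have hma_ne : mu - alpha ≠ 0 := (sub_pos.mpr ham').ne'
  have hla_ne : lam - alpha ≠ 0 := (sub_pos.mpr hal).ne'
  have hmla_ne : mu - lam - alpha ≠ 0 := (sub_pos.mpr ham).ne'
  rw [show (alpha - mu) ^ 2 = (mu - alpha) ^ 2 by ring,
    show lam * (lam - mu) = -(lam * (mu - lam)) by ring]
  field_simp
  ring
end

section
/- For all real numbers 0 < λ < μ and α > 0, letting ρ = λ/μ and writing Ei(−x) = −E1(x) for x > 0, the average logarithmic PCoUD of the M/M/1 FCFS system satisfies ∫_0^∞ log(α t + 1)·A(t) dt = (1/(αλ(λ−μ)))·( e^{−μρ/α}·( α(μ−λ)·( μ e^{μ/α}·Ei(−μ(1−ρ)/α) + λ e^{μρ/α} ) − Ei(−μ/α)·( α(λ² − λμ + μ²) + λμ(λ−μ) )·e^{μ(ρ+1)/α} ) + αλμ e^{λ/α}·Ei(−λ/α) ). -/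
open MeasureTheory Real

/-- The exponential integral `E1 x = ∫_x^∞ e^{−t}/t dt`; the paper's `Ei` satisfies
`Ei (−x) = −E1 x` for `x > 0`. -/
noncomputable def E1 (x : ℝ) : ℝ := ∫ t in Set.Ioi x, Real.exp (-t) / t

open Filter Topology Set

lemma log_mul_add_one_le {a t : ℝ} (ha : 0 < a) (ht : 0 ≤ t) : log (a * t + 1) ≤ a * t := by
  have := log_le_sub_one_of_pos (show 0 < a * t + 1 by positivity)
  linarith

lemma log_mul_add_one_nonneg {a t : ℝ} (ha : 0 < a) (ht : 0 ≤ t) : 0 ≤ log (a * t + 1) :=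
  log_nonneg (by nlinarith [mul_nonneg ha.le ht])

lemma integrableOn_pow_mul_exp_neg_mul (n : ℕ) {c : ℝ} (hc : 0 < c) :
    IntegrableOn (fun t : ℝ => t ^ n * exp (-c * t)) (Ioi 0) := by
  have h := integrableOn_rpow_mul_exp_neg_mul_rpow (s := n) (p := 1) (b := c)
    (by have := n.cast_nonneg (α := ℝ); linarith) one_pos hc
  simpa using h

lemma integrableOn_pow_mul_log_mul_exp (n : ℕ) {a c : ℝ} (ha : 0 < a) (hc : 0 < c) :
    IntegrableOn (fun t : ℝ => t ^ n * log (a * t + 1) * exp (-c * t)) (Ioi 0) := by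
  refine ((integrableOn_pow_mul_exp_neg_mul (n + 1) hc).const_mul a).mono'
    (by fun_prop) ?_
  filter_upwards [ae_restrict_mem measurableSet_Ioi] with t ht
  have ht' : (0 : ℝ) ≤ t := le_of_lt ht
  have h0 := log_mul_add_one_nonneg ha ht'
  rw [norm_of_nonneg (by positivity)]
  calc t ^ n * log (a * t + 1) * exp (-c * t) ≤ t ^ n * (a * t) * exp (-c * t) := by
        gcongr
        exact log_mul_add_one_le ha ht'
    _ = a * (t ^ (n + 1) * exp (-c * t)) := by ring

lemma tendsto_pow_mul_log_mul_exp (n : ℕ) {a c : ℝ} (ha : 0 < a) (hc : 0 < c) :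
    Tendsto (fun t : ℝ => t ^ n * log (a * t + 1) * exp (-c * t)) atTop (𝓝 0) := by
  have h := (tendsto_rpow_mul_exp_neg_mul_atTop_nhds_zero ((n + 1 : ℕ) : ℝ) c hc).const_mul a
  simp only [rpow_natCast, mul_zero] at h
  refine squeeze_zero' ?_ ?_ h
  · filter_upwards [eventually_ge_atTop 0] with t ht
    have := log_mul_add_one_nonneg ha ht
    positivity
  · filter_upwards [eventually_ge_atTop 0] with t ht
    calc t ^ n * log (a * t + 1) * exp (-c * t) ≤ t ^ n * (a * t) * exp (-c * t) := by
          gcongr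
          exact log_mul_add_one_le ha ht
      _ = a * (t ^ (n + 1) * exp (-c * t)) := by ring

lemma integrableOn_div_mul_exp {a c : ℝ} (ha : 0 < a) (hc : 0 < c) :
    IntegrableOn (fun t : ℝ => a / (a * t + 1) * exp (-c * t)) (Ioi 0) := by
  refine ((integrableOn_pow_mul_exp_neg_mul 0 hc).const_mul a).mono'
    (by fun_prop) ?_
  filter_upwards [ae_restrict_mem measurableSet_Ioi] with t ht
  have ht' : (0 : ℝ) < t := ht
  rw [norm_of_nonneg (by positivity), pow_zero, one_mul]
  gcongr
  exact div_le_self ha.le (by nlinarith [mul_pos ha ht'])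

/-- The Laplace transform of `a / (a t + 1)` in terms of the exponential integral. -/
lemma integral_div_mul_exp {a c : ℝ} (ha : 0 < a) (hc : 0 < c) :
    ∫ t in Ioi (0 : ℝ), a / (a * t + 1) * exp (-c * t) = exp (c / a) * E1 (c / a) := by
  have hshift : E1 (c / a) = ∫ t in Ioi (0 : ℝ), exp (-(t + c / a)) / (t + c / a) := by
    have := (measurePreserving_add_right volume (c / a)).setIntegral_preimage_emb
      (measurableEmbedding_addRight (c / a)) (fun t : ℝ => exp (-t) / t) (Ioi (c / a))
    rw [preimage_add_const_Ioi, sub_self] at this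
    exact this.symm
  have hscale := integral_comp_mul_left_Ioi' (fun t : ℝ => exp (-(t + c / a)) / (t + c / a)) 0 hc
  rw [mul_zero, ← hshift] at hscale
  rw [← hscale, smul_eq_mul, ← mul_assoc, ← integral_const_mul]
  refine setIntegral_congr_fun measurableSet_Ioi fun t ht => ?_
  have ht' : (0 : ℝ) < t := ht
  have hsplit : exp (-c * t) = exp (c / a) * exp (-(c * t + c / a)) := by
    rw [← exp_add]; ring_nf
  have h1 : a * t + 1 ≠ 0 := by positivity
  have h2 : c * t + c / a ≠ 0 := by positivity
  have h3 : a / (a * t + 1) = c / (c * t + c / a) := by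
    rw [div_eq_div_iff h1 h2]; field_simp
  simp only [hsplit, h3]
  ring

lemma hasDerivAt_log_mul_add_one {a t : ℝ} (h : a * t + 1 ≠ 0) :
    HasDerivAt (fun t : ℝ => log (a * t + 1)) (a / (a * t + 1)) t := by
  simpa using (((hasDerivAt_id t).const_mul a).add_const 1).log h

lemma hasDerivAt_exp_neg_mul (c t : ℝ) :
    HasDerivAt (fun t : ℝ => exp (-c * t)) (exp (-c * t) * -c) t := by
  simpa using ((hasDerivAt_id t).const_mul (-c)).exp

/-- The Laplace transform of `log (a t + 1)`. -/
lemma integral_log_mul_exp {a c : ℝ} (ha : 0 < a) (hc : 0 < c) :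
    ∫ t in Ioi (0 : ℝ), log (a * t + 1) * exp (-c * t) = exp (c / a) * E1 (c / a) / c := by
  have hint : IntegrableOn (fun t : ℝ => log (a * t + 1) * exp (-c * t)) (Ioi 0) := by
    simpa using integrableOn_pow_mul_log_mul_exp 0 ha hc
  have hdiv := integrableOn_div_mul_exp ha hc
  have hlim : Tendsto (fun t : ℝ => log (a * t + 1) * exp (-c * t)) atTop (𝓝 0) := by
    simpa using tendsto_pow_mul_log_mul_exp 0 ha hc
  have key := integral_Ioi_of_hasDerivAt_of_tendsto' (a := 0)
    (f := fun t : ℝ => log (a * t + 1) * exp (-c * t))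
    (f' := fun t : ℝ => a / (a * t + 1) * exp (-c * t) - c * (log (a * t + 1) * exp (-c * t)))
    (fun t ht => by
      have ht' : (0 : ℝ) ≤ t := ht
      refine ((hasDerivAt_log_mul_add_one (by positivity)).mul
        (hasDerivAt_exp_neg_mul c t)).congr_deriv ?_
      ring)
    (hdiv.sub (hint.const_mul c)) hlim
  rw [integral_sub hdiv (hint.const_mul c), integral_const_mul, integral_div_mul_exp ha hc] at key
  simp only [mul_zero, zero_add, log_one, zero_mul, sub_zero] at key
  rw [eq_div_iff hc.ne']
  linarith

/-- The Laplace transform of `t log (a t + 1)`. -/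
lemma integral_id_mul_log_mul_exp {a c : ℝ} (ha : 0 < a) (hc : 0 < c) :
    ∫ t in Ioi (0 : ℝ), t * log (a * t + 1) * exp (-c * t)
      = (1 / c ^ 2 - 1 / (c * a)) * (exp (c / a) * E1 (c / a)) + 1 / c ^ 2 := by
  have hlog : IntegrableOn (fun t : ℝ => log (a * t + 1) * exp (-c * t)) (Ioi 0) := by
    simpa using integrableOn_pow_mul_log_mul_exp 0 ha hc
  have hint : IntegrableOn (fun t : ℝ => t * log (a * t + 1) * exp (-c * t)) (Ioi 0) := by
    simpa using integrableOn_pow_mul_log_mul_exp 1 ha hc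
  have hexp : IntegrableOn (fun t : ℝ => exp (-c * t)) (Ioi 0) := by
    simpa using integrableOn_pow_mul_exp_neg_mul 0 hc
  have hdiv := integrableOn_div_mul_exp ha hc
  have hlim : Tendsto (fun t : ℝ => t * log (a * t + 1) * exp (-c * t)) atTop (𝓝 0) := by
    simpa using tendsto_pow_mul_log_mul_exp 1 ha hc
  have key := integral_Ioi_of_hasDerivAt_of_tendsto' (a := 0)
    (f := fun t : ℝ => t * log (a * t + 1) * exp (-c * t))
    (f' := fun t : ℝ => ((log (a * t + 1) * exp (-c * t) + exp (-c * t))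
      - 1 / a * (a / (a * t + 1) * exp (-c * t))) - c * (t * log (a * t + 1) * exp (-c * t)))
    (fun t ht => by
      have ht' : (0 : ℝ) ≤ t := ht
      have hne : a * t + 1 ≠ 0 := by positivity
      refine (((hasDerivAt_id t).mul (hasDerivAt_log_mul_add_one hne)).mul
        (hasDerivAt_exp_neg_mul c t)).congr_deriv ?_
      simp only [id_eq, Pi.mul_apply]
      field_simp
      ring)
    (((hlog.add hexp).sub (hdiv.const_mul (1 / a))).sub (hint.const_mul c)) hlim
  have hadd := Integrable.fun_add hlog hexp
  have hdiv_mul := Integrable.const_mul hdiv (1 / a)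
  rw [integral_sub (hadd.sub' hdiv_mul) (hint.const_mul c),
    integral_sub hadd hdiv_mul, integral_add hlog hexp,
    integral_const_mul, integral_const_mul, integral_div_mul_exp ha hc,
    integral_log_mul_exp ha hc, integral_exp_mul_Ioi (neg_neg_of_pos hc)] at key
  simp only [mul_zero, zero_mul, sub_zero, exp_zero] at key
  generalize exp (c / a) * E1 (c / a) = G at key ⊢
  generalize (∫ t in Ioi (0 : ℝ), t * log (a * t + 1) * exp (-c * t)) = I at key ⊢
  have hI : I = (G / c + -1 / -c - 1 / a * G) / c := by
    rw [eq_div_iff hc.ne']; linarith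
  rw [hI]
  field_simp
  ring

/-- Average logarithmic PCoUD of the M/M/1 FCFS queue (Theorem 3), with `ρ = λ/μ` and
`Ei(−x) = −E1(x)`. -/
theorem avg_logarithmic_PCoUD (lam mu alpha : ℝ) (hlam : 0 < lam) (hlm : lam < mu)
    (halpha : 0 < alpha) :
    (∫ t in Set.Ioi (0:ℝ), Real.log (alpha * t + 1) *
        ((mu * (2 * lam ^ 2 - 2 * lam * mu + mu ^ 2) / (lam * (lam - mu))) * Real.exp (-mu * t)
          + (mu * (mu - lam) / lam) * Real.exp (-(mu - lam) * t)
          + (lam * mu / (mu - lam)) * Real.exp (-lam * t)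
          - mu ^ 2 * t * Real.exp (-mu * t)))
      = (1 / (alpha * lam * (lam - mu))) *
          (Real.exp (-(mu * (lam / mu)) / alpha) *
            (alpha * (mu - lam) *
                (mu * Real.exp (mu / alpha) * (-E1 (mu * (1 - lam / mu) / alpha))
                  + lam * Real.exp (mu * (lam / mu) / alpha))
              - (-E1 (mu / alpha)) *
                  (alpha * (lam ^ 2 - lam * mu + mu ^ 2) + lam * mu * (lam - mu))
                  * Real.exp (mu * (lam / mu + 1) / alpha))
            + alpha * lam * mu * Real.exp (lam / alpha) * (-E1 (lam / alpha))) := by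
  have hmu : 0 < mu := hlam.trans hlm
  have hd : 0 < mu - lam := sub_pos.mpr hlm
  have hint : ∀ {c : ℝ}, 0 < c →
      IntegrableOn (fun t : ℝ => log (alpha * t + 1) * exp (-c * t)) (Ioi 0) := fun hc => by
    simpa using integrableOn_pow_mul_log_mul_exp 0 halpha hc
  have hint_id : IntegrableOn (fun t : ℝ => t * log (alpha * t + 1) * exp (-mu * t)) (Ioi 0) := by
    simpa using integrableOn_pow_mul_log_mul_exp 1 halpha hmu
  set A := mu * (2 * lam ^ 2 - 2 * lam * mu + mu ^ 2) / (lam * (lam - mu)) with hA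
  set B := mu * (mu - lam) / lam with hB
  set C := lam * mu / (mu - lam) with hC
  have hexpand : ∀ t : ℝ, log (alpha * t + 1) * (A * exp (-mu * t) + B * exp (-(mu - lam) * t)
        + C * exp (-lam * t) - mu ^ 2 * t * exp (-mu * t))
      = A * (log (alpha * t + 1) * exp (-mu * t))
        + B * (log (alpha * t + 1) * exp (-(mu - lam) * t))
        + C * (log (alpha * t + 1) * exp (-lam * t))
        - mu ^ 2 * (t * log (alpha * t + 1) * exp (-mu * t)) := fun t => by ring
  have hAi := (hint hmu).const_mul A
  have hBi := (hint hd).const_mul B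
  have hCi := (hint hlam).const_mul C
  simp only [hexpand]
  rw [integral_sub ((hAi.fun_add hBi).fun_add hCi) (hint_id.const_mul (mu ^ 2)),
    integral_add (hAi.fun_add hBi) hCi, integral_add hAi hBi]
  simp only [integral_const_mul]
  rw [integral_log_mul_exp halpha hmu, integral_log_mul_exp halpha hd,
    integral_log_mul_exp halpha hlam, integral_id_mul_log_mul_exp halpha hmu]
  have hrho : mu * (lam / mu) = lam := mul_div_cancel₀ lam hmu.ne'
  have hrho_sub : mu * (1 - lam / mu) = mu - lam := by rw [mul_sub, hrho, mul_one]
  have hrho_add : mu * (lam / mu + 1) = lam + mu := by rw [mul_add, hrho, mul_one]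
  rw [hrho, hrho_sub, hrho_add, sub_div, add_div, neg_div, exp_sub, exp_add, exp_neg, hA, hB, hC]
  have hne : lam - mu ≠ 0 := (sub_neg.mpr hlm).ne
  have hlam_exp := (exp_pos (lam / alpha)).ne'
  generalize exp (lam / alpha) = x at *
  generalize exp (mu / alpha) = y at *
  rw [← neg_sub lam mu] at *
  generalize E1 (lam / alpha) = e₁ at *
  generalize E1 (mu / alpha) = e₂ at *
  generalize E1 _ = e₃ at *
  field_simp
  ring
end

section
/- For all real numbers α > 0 and β > 0, ∫_0^∞ α t·log(α t + 1)·β e^{−β t} dt = ( (α−β)·e^{β/α}·E1(β/α) + α ) / β; equivalently, E[αT·log(αT+1)] for T exponential with rate β equals −(1/β)·( (α−β)·e^{β/α}·Ei(−β/α) − α ). -/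
open MeasureTheory Real

open Filter Topology

theorem integrableOn_exp_neg_div {x : ℝ} (hx : 0 < x) :
    IntegrableOn (fun t : ℝ => exp (-t) / t) (Set.Ioi x) := by
  refine ((integrableOn_exp_neg_Ioi x).const_mul x⁻¹).mono'
    (Measurable.aestronglyMeasurable (by fun_prop)) ?_
  filter_upwards [ae_restrict_mem measurableSet_Ioi] with t (ht : x < t)
  have ht0 : 0 < t := hx.trans ht
  rw [norm_of_nonneg (by positivity), div_eq_inv_mul]
  gcongr

theorem E1_eq_sub_intervalIntegral {a x : ℝ} (ha : 0 < a) (hx : 0 < x) :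
    E1 x = E1 a - ∫ t in a..x, exp (-t) / t := by
  have h := intervalIntegral.integral_Ioi_sub_Ioi' (integrableOn_exp_neg_div ha)
    (integrableOn_exp_neg_div hx)
  rw [E1, E1, ← h]
  ring

theorem hasDerivAt_E1 {x : ℝ} (hx : 0 < x) : HasDerivAt E1 (-(exp (-x) / x)) x := by
  have hcont : ContinuousAt (fun t : ℝ => exp (-t) / t) x :=
    ContinuousAt.div (by fun_prop) continuousAt_id hx.ne'
  have hint := intervalIntegral.integral_hasDerivAt_right (a := x)
    IntervalIntegrable.refl
    (Measurable.stronglyMeasurable (by fun_prop)).stronglyMeasurableAtFilter hcont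
  refine (hint.const_sub (E1 x)).congr_of_eventuallyEq ?_
  filter_upwards [lt_mem_nhds hx] with y hy using E1_eq_sub_intervalIntegral hx hy

theorem tendsto_E1_atTop : Tendsto E1 atTop (𝓝 0) := by
  have h := (intervalIntegral_tendsto_integral_Ioi 1 (integrableOn_exp_neg_div one_pos)
    tendsto_id).const_sub (E1 1)
  rw [← E1, sub_self] at h
  refine h.congr' ?_
  filter_upwards [eventually_gt_atTop 0] with y hy using
    (E1_eq_sub_intervalIntegral one_pos hy).symm

theorem tendsto_pow_mul_exp_neg_mul_atTop (n : ℕ) {b : ℝ} (hb : 0 < b) :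
    Tendsto (fun t : ℝ => t ^ n * exp (-b * t)) atTop (𝓝 0) := by
  have h := ((tendsto_pow_mul_exp_neg_atTop_nhds_zero n).comp
    (tendsto_id.const_mul_atTop hb)).const_mul ((b ^ n)⁻¹)
  rw [mul_zero] at h
  refine h.congr fun t => ?_
  simp only [Function.comp, id, mul_pow, neg_mul]
  field_simp

theorem tendsto_exp_mul_linear_mul_log_atTop {a b : ℝ} (c : ℝ) (ha : 0 < a) (hb : 0 < b)
    (hc : 0 ≤ c) :
    Tendsto (fun t : ℝ => exp (-b * t) * (a * t + c) * log (a * t + 1)) atTop (𝓝 0) := by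
  have hbound : Tendsto (fun t : ℝ => exp (-b * t) * (a * t + c) * (a * t)) atTop (𝓝 0) := by
    have h := ((tendsto_pow_mul_exp_neg_mul_atTop 2 hb).const_mul (a ^ 2)).add
      ((tendsto_pow_mul_exp_neg_mul_atTop 1 hb).const_mul (c * a))
    rw [mul_zero, mul_zero, add_zero] at h
    exact h.congr fun t => by ring
  refine squeeze_zero' ?_ ?_ hbound
  · filter_upwards [eventually_ge_atTop 0] with t ht
    have hlog : 0 ≤ log (a * t + 1) := log_nonneg (by nlinarith [mul_nonneg ha.le ht])
    positivity
  · filter_upwards [eventually_ge_atTop 0] with t ht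
    have hlog : log (a * t + 1) ≤ a * t := by
      linarith [log_le_sub_one_of_pos (show 0 < a * t + 1 by positivity)]
    gcongr

/-- An antiderivative of `t ↦ a t log (a t + 1) · b e^{-b t}` on `[0, ∞)`. -/
noncomputable def mulLogExpAntideriv (a b t : ℝ) : ℝ :=
  -(exp (-b * t) * (a * t + a / b) * log (a * t + 1)) - a / b * exp (-b * t)
    - (a / b - 1) * exp (b / a) * E1 (b * t + b / a)

theorem hasDerivAt_mulLogExpAntideriv {a b t : ℝ} (ha : 0 < a) (hb : 0 < b) (ht : 0 ≤ t) :
    HasDerivAt (mulLogExpAntideriv a b) (a * t * log (a * t + 1) * (b * exp (-b * t))) t := by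
  have hlin (c d : ℝ) : HasDerivAt (fun s : ℝ => c * s + d) c t := by
    simpa using ((hasDerivAt_id t).const_mul c).add_const d
  have hexp : HasDerivAt (fun s : ℝ => exp (-b * s)) (exp (-b * t) * -b) t := by
    simpa using (hlin (-b) 0).exp
  have hpos : 0 < a * t + 1 := by positivity
  have hlog := (hlin a 1).log hpos.ne'
  have hE1 := (hasDerivAt_E1 (x := b * t + b / a) (by positivity)).comp t (hlin b (b / a))
  have h := (((hexp.mul (hlin a (a / b))).mul hlog).neg.sub (hexp.const_mul (a / b))).sub
    (hE1.const_mul ((a / b - 1) * exp (b / a)))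
  refine h.congr_deriv ?_
  have hsplit : exp (-(b * t + b / a)) = exp (-b * t) * (exp (b / a))⁻¹ := by
    rw [← exp_neg, ← exp_add]
    ring_nf
  have harg : b * t + b / a = b / a * (a * t + 1) := by field_simp
  rw [hsplit, harg]
  simp only [Pi.mul_apply]
  field_simp
  ring

theorem tendsto_mulLogExpAntideriv_atTop {a b : ℝ} (ha : 0 < a) (hb : 0 < b) :
    Tendsto (mulLogExpAntideriv a b) atTop (𝓝 0) := by
  have hE1 := tendsto_E1_atTop.comp
    (tendsto_atTop_add_const_right atTop (b / a) (tendsto_id.const_mul_atTop hb))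
  have h := ((tendsto_exp_mul_linear_mul_log_atTop (a / b) ha hb (by positivity)).neg.sub
    ((tendsto_pow_mul_exp_neg_mul_atTop 0 hb).const_mul (a / b))).sub
    (hE1.const_mul ((a / b - 1) * exp (b / a)))
  simp only [pow_zero, one_mul, mul_zero, neg_zero, sub_zero] at h
  exact h

/-- For `T` exponential with rate `β`,
`E[αT log(αT + 1)] = ((α−β) e^{β/α} E1(β/α) + α)/β`. -/
theorem exp_mul_log_exponential (alpha beta : ℝ) (halpha : 0 < alpha) (hbeta : 0 < beta) :
    (∫ t in Set.Ioi (0:ℝ), alpha * t * Real.log (alpha * t + 1) * (beta * Real.exp (-beta * t)))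
      = ((alpha - beta) * Real.exp (beta / alpha) * E1 (beta / alpha) + alpha) / beta := by
  rw [integral_Ioi_of_hasDerivAt_of_nonneg'
    (fun t ht => hasDerivAt_mulLogExpAntideriv halpha hbeta ht) (fun t (ht : 0 < t) => ?_)
    (tendsto_mulLogExpAntideriv_atTop halpha hbeta)]
  · simp only [mulLogExpAntideriv, mul_zero, zero_add, log_one, exp_zero]
    field_simp
    ring
  · have hlog : 0 ≤ log (alpha * t + 1) := log_nonneg (by nlinarith [mul_pos halpha ht])
    positivity
end
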